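/- Let d ≥ 2 and let {|e^a_x⟩}_{x=1}^d for a = 1, …, d be d pairwise mutually unbiased orthonormal bases of ℂ^d. For x ∈ {1,…,d} define ρ^x = (1/d) Σ_{a=1}^d |a⟩⟨a| ⊗ |e^a_x⟩⟨e^a_x| on A⊗B with A = ℂ^d, B = ℂ^d. Then for any finite-dimensional Hilbert spaces A', B', any density matrix η on A'⊗B', any POVM {E^α}_{α∈I} on A⊗A', any POVM {F^β}_{β∈J} on B⊗B', and any function g: I×J → {1,…,d}, the success probability p_succ = (1/d) Σ_{x=1}^d Σ_{(α,β): g(α,β)=x} tr[(E^α⊗F^β)(ρ^x ⊗ η)] satisfies p_succ ≤ 2·dim(B')/√d. -/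

import Mathlib

open scoped ComplexOrder

/-- A POVM on a finite-dimensional Hilbert space: a finite family of positive semidefinite
operators summing to the identity. -/
def IsPOVM {ι H : Type*} [Fintype ι] [Fintype H] [DecidableEq H]
    (E : ι → Matrix H H ℂ) : Prop :=
  (∀ i, (E i).PosSemidef) ∧ (∑ i, E i) = 1

/-- A family of vectors `e x : ℂ^d`, `x : Fin d`, forms an orthonormal basis. -/
def IsONB {d : ℕ} (e : Fin d → Fin d → ℂ) : Prop :=
  ∀ x y, (∑ i, (starRingEnd ℂ) (e x i) * e y i) = if x = y then 1 else 0

/-- A family of orthonormal bases of `ℂ^d`, indexed by `a : ι`, is pairwise mutually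
unbiased: `|⟨e^a_x, e^b_y⟩|² = 1/d` for all `a ≠ b` and all `x, y`. -/
def MutuallyUnbiasedBases {d : ℕ} {ι : Type*} (e : ι → Fin d → Fin d → ℂ) : Prop :=
  (∀ a, IsONB (e a)) ∧
  ∀ a b, a ≠ b → ∀ x y, ‖∑ i, (starRingEnd ℂ) (e a x i) * e b y i‖ ^ 2 = 1 / d

/-- The state `ρ^x = (1/d) ∑ a, |a⟩⟨a| ⊗ |e^a_x⟩⟨e^a_x|` on `A ⊗ B` with
`A = B = ℂ^d`, built from `d` mutually unbiased bases. -/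
noncomputable def rhoMUB' (d : ℕ) (e : Fin d → Fin d → Fin d → ℂ) (x : Fin d) :
    Matrix (Fin d × Fin d) (Fin d × Fin d) ℂ :=
  Matrix.of fun p q =>
    if p.1 = q.1 then (1 / (d : ℂ)) * e p.1 x p.2 * (starRingEnd ℂ) (e p.1 x q.2)
    else 0

/-- `tr[(E ⊗ F)(ρ ⊗ η)]`, where `E` acts on `A ⊗ A'`, `F` on `B ⊗ B'`, `ρ` lives on
`A ⊗ B` and `η` on `A' ⊗ B'` (tensor factors reordered appropriately). -/
noncomputable def corrProb {A A' B B' : Type*} [Fintype A] [Fintype A'] [Fintype B] [Fintype B']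
    (E : Matrix (A × A') (A × A') ℂ) (F : Matrix (B × B') (B × B') ℂ)
    (ρ : Matrix (A × B) (A × B) ℂ) (η : Matrix (A' × B') (A' × B') ℂ) : ℂ :=
  ∑ a : A, ∑ a₁ : A, ∑ b : B, ∑ b₁ : B, ∑ a' : A', ∑ a₁' : A', ∑ b' : B', ∑ b₁' : B',
    E (a, a') (a₁, a₁') * F (b, b') (b₁, b₁') * ρ (a₁, b₁) (a, b) * η (a₁', b₁') (a', b')

open scoped InnerProductSpace in
/-- An almost-orthogonality (Bessel-type) inequality: unit vectors whose pairwise overlaps are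
at most `c` satisfy `∑ a, |⟨v a, w⟩|² ≤ (1 + c * n) ‖w‖²`. -/
lemma sum_norm_inner_sq_le {V ι : Type*} [NormedAddCommGroup V] [InnerProductSpace ℂ V]
    [Fintype ι] (v : ι → V) (c : ℝ) (hc : 0 ≤ c) (hv : ∀ a, ‖v a‖ = 1)
    (hvc : ∀ a b, a ≠ b → ‖⟪v a, v b⟫_ℂ‖ ≤ c) (w : V) :
    ∑ a, ‖⟪v a, w⟫_ℂ‖ ^ 2 ≤ (1 + c * Fintype.card ι) * ‖w‖ ^ 2 := by
  classical
  set S := ∑ a, ‖⟪v a, w⟫_ℂ‖ ^ 2 with hS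
  have hS0 : 0 ≤ S := Finset.sum_nonneg fun a _ => sq_nonneg _
  set u : V := ∑ a, ⟪v a, w⟫_ℂ • v a with hu
  have huw : ⟪u, w⟫_ℂ = (S : ℂ) := by
    rw [hu, sum_inner, hS, Complex.ofReal_sum]
    refine Finset.sum_congr rfl fun a _ => ?_
    rw [inner_smul_left, mul_comm, Complex.mul_conj', Complex.ofReal_pow]
  have hSle : S ≤ ‖u‖ * ‖w‖ := by
    have h := norm_inner_le_norm (𝕜 := ℂ) u w
    rwa [huw, Complex.norm_real, Real.norm_of_nonneg hS0] at h
  have hentry : ∀ a b, ‖⟪v a, v b⟫_ℂ‖ ≤ (if a = b then 1 else 0) + c := by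
    intro a b
    by_cases hab : a = b
    · subst hab
      have h := norm_inner_le_norm (𝕜 := ℂ) (v a) (v a)
      rw [hv a] at h
      rw [if_pos rfl]
      linarith
    · simpa [hab] using hvc a b hab
  have hu2 : ‖u‖ ^ 2 ≤ (1 + c * Fintype.card ι) * S := by
    have h1 : ‖u‖ ^ 2 ≤ ∑ a, ∑ b, ‖⟪v a, w⟫_ℂ‖ * ‖⟪v b, w⟫_ℂ‖ *
        ((if a = b then 1 else 0) + c) := by
      have h2 : ‖u‖ ^ 2 = ‖⟪u, u⟫_ℂ‖ := by
        rw [inner_self_eq_norm_sq_to_K]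
        simp
      rw [h2]
      conv_lhs => rw [hu, sum_inner]
      refine (norm_sum_le _ _).trans (Finset.sum_le_sum fun a _ => ?_)
      rw [inner_sum]
      refine (norm_sum_le _ _).trans (Finset.sum_le_sum fun b _ => ?_)
      rw [inner_smul_left, inner_smul_right, norm_mul, norm_mul, RCLike.norm_conj, ← mul_assoc]
      exact mul_le_mul_of_nonneg_left (hentry a b) (by positivity)
    have h3 : ∑ a, ∑ b, ‖⟪v a, w⟫_ℂ‖ * ‖⟪v b, w⟫_ℂ‖ * ((if a = b then 1 else 0) + c) =
        S + c * (∑ a, ‖⟪v a, w⟫_ℂ‖) ^ 2 := by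
      simp only [mul_add, Finset.sum_add_distrib, mul_ite, mul_one, mul_zero,
        Finset.sum_ite_eq, Finset.mem_univ, if_true]
      rw [hS, sq (∑ a, _), Finset.sum_mul_sum, Finset.mul_sum]
      congr 1
      · exact Finset.sum_congr rfl fun a _ => (sq _).symm
      · refine Finset.sum_congr rfl fun a _ => ?_
        rw [Finset.mul_sum]
        exact Finset.sum_congr rfl fun b _ => by ring
    have h4 : (∑ a, ‖⟪v a, w⟫_ℂ‖) ^ 2 ≤ Fintype.card ι * S :=
      sq_sum_le_card_mul_sum_sq
    have h5 := mul_le_mul_of_nonneg_left h4 hc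
    linarith
  rcases hS0.eq_or_lt with h0 | hpos
  · rw [← h0]
    positivity
  · have h6 : S ^ 2 ≤ ‖u‖ ^ 2 * ‖w‖ ^ 2 := by
      rw [← mul_pow]
      exact pow_le_pow_left₀ hS0 hSle 2
    have h7 : S * S ≤ S * ((1 + c * Fintype.card ι) * ‖w‖ ^ 2) := by
      have := mul_le_mul_of_nonneg_right hu2 (sq_nonneg ‖w‖)
      nlinarith
    exact le_of_mul_le_mul_left h7 hpos

/-- The trace of `Gᴴ * G` is the squared Frobenius norm of `G`. -/
lemma trace_conjTranspose_mul_self_re {m n : Type*} [Fintype m] [Fintype n]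
    (G : Matrix m n ℂ) : (G.conjTranspose * G).trace.re = ∑ j, ∑ i, ‖G i j‖ ^ 2 := by
  simp only [Matrix.trace, Matrix.diag_apply, Matrix.mul_apply, Matrix.conjTranspose_apply,
    Complex.re_sum]
  refine Finset.sum_congr rfl fun j _ => Finset.sum_congr rfl fun i _ => ?_
  rw [Complex.star_def, Complex.conj_mul']
  norm_cast

open scoped MatrixOrder Matrix.Norms.L2Operator in
lemma exists_eq_conjTranspose_mul_self {n : Type*} [Fintype n] {P : Matrix n n ℂ}
    (hP : P.PosSemidef) : ∃ G : Matrix n n ℂ, P = G.conjTranspose * G := by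
  classical
  exact CStarAlgebra.nonneg_iff_eq_star_mul_self.mp hP.nonneg

/-- The trace of a product of positive semidefinite matrices is at most the product of
the traces. -/
lemma trace_mul_re_le {n : Type*} [Fintype n] {N M : Matrix n n ℂ}
    (hN : N.PosSemidef) (hM : M.PosSemidef) :
    (N * M).trace.re ≤ N.trace.re * M.trace.re := by
  classical
  obtain ⟨G, rfl⟩ := exists_eq_conjTranspose_mul_self hN
  obtain ⟨H, rfl⟩ := exists_eq_conjTranspose_mul_self hM
  have hcyc : (G.conjTranspose * G * (H.conjTranspose * H)).trace =
      ((G * H.conjTranspose).conjTranspose * (G * H.conjTranspose)).trace := by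
    rw [Matrix.conjTranspose_mul, Matrix.conjTranspose_conjTranspose, Matrix.mul_assoc H,
      Matrix.trace_mul_comm H]
    simp only [Matrix.mul_assoc]
  rw [hcyc]
  simp only [trace_conjTranspose_mul_self_re]
  have hle : ∀ i j, ‖(G * H.conjTranspose) i j‖ ^ 2 ≤
      (∑ k, ‖G i k‖ ^ 2) * ∑ k, ‖H j k‖ ^ 2 := by
    intro i j
    refine le_trans ?_ (Finset.sum_mul_sq_le_sq_mul_sq _ _ _)
    refine pow_le_pow_left₀ (norm_nonneg _) ?_ 2
    rw [Matrix.mul_apply]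
    refine (norm_sum_le _ _).trans (le_of_eq (Finset.sum_congr rfl fun k _ => ?_))
    rw [norm_mul, Matrix.conjTranspose_apply, norm_star]
  calc ∑ j, ∑ i, ‖(G * H.conjTranspose) i j‖ ^ 2
      ≤ ∑ j, ∑ i, (∑ k, ‖G i k‖ ^ 2) * ∑ k, ‖H j k‖ ^ 2 :=
        Finset.sum_le_sum fun j _ => Finset.sum_le_sum fun i _ => hle i j
    _ = (∑ j, ∑ i, ‖G i j‖ ^ 2) * ∑ j, ∑ i, ‖H i j‖ ^ 2 := by
        rw [Finset.sum_comm (f := fun j i => ‖G i j‖ ^ 2),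
          Finset.sum_comm (f := fun j i => ‖H i j‖ ^ 2), Finset.sum_mul_sum, Finset.sum_comm]

/-- Positive semidefinite quadratic forms summed over almost orthogonal unit vectors are
controlled by the trace. -/
lemma sum_dotProduct_mulVec_re_le {n ι : Type*} [Fintype n] [Fintype ι]
    {P : Matrix n n ℂ} (hP : P.PosSemidef) (v : ι → n → ℂ) (c : ℝ) (hc : 0 ≤ c)
    (hv : ∀ a, star (v a) ⬝ᵥ v a = 1)
    (hvc : ∀ a b, a ≠ b → ‖star (v a) ⬝ᵥ v b‖ ≤ c) :
    ∑ a, (star (v a) ⬝ᵥ P.mulVec (v a)).re ≤ (1 + c * Fintype.card ι) * P.trace.re := by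
  classical
  obtain ⟨G, rfl⟩ := exists_eq_conjTranspose_mul_self hP
  have hinner : ∀ x y : n → ℂ,
      inner ℂ (WithLp.toLp 2 x : EuclideanSpace ℂ n) (WithLp.toLp 2 y) = star x ⬝ᵥ y := by
    intro x y
    rw [EuclideanSpace.inner_toLp_toLp, dotProduct_comm]
  have hquad : ∀ a, (star (v a) ⬝ᵥ (G.conjTranspose * G).mulVec (v a)).re =
      ∑ k, ‖star (v a) ⬝ᵥ star (G k)‖ ^ 2 := by
    intro a
    rw [← Matrix.mulVec_mulVec, Matrix.dotProduct_mulVec, ← Matrix.star_mulVec]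
    simp only [dotProduct, Complex.re_sum, Pi.star_apply]
    refine Finset.sum_congr rfl fun k _ => ?_
    rw [Complex.star_def, Complex.conj_mul']
    norm_cast
    congr 1
    rw [← norm_star]
    simp [Matrix.mulVec, dotProduct, mul_comm]
  simp only [hquad]
  rw [Finset.sum_comm, trace_conjTranspose_mul_self_re,
    Finset.sum_comm (f := fun j i => ‖G i j‖ ^ 2), Finset.mul_sum]
  refine Finset.sum_le_sum fun k _ => ?_
  have h := sum_norm_inner_sq_le (fun a => (WithLp.toLp 2 (v a) : EuclideanSpace ℂ n)) c hc
    (fun a => by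
      have h2 : ‖(WithLp.toLp 2 (v a) : EuclideanSpace ℂ n)‖ ^ 2 = 1 := by
        rw [← inner_self_eq_norm_sq (𝕜 := ℂ), hinner, hv a]
        exact Complex.one_re
      exact (pow_eq_one_iff_of_nonneg (norm_nonneg _) two_ne_zero).mp h2)
    (fun a b hab => by rw [hinner]; exact hvc a b hab)
    (WithLp.toLp 2 (star (G k)))
  simpa only [hinner, EuclideanSpace.norm_sq_eq, Pi.star_apply, norm_star] using h

/-- The partial contraction `⟨u| P |u⟩` of an operator on a tensor product along a vector of
the first factor. -/
noncomputable def partialContract {X Y : Type*} [Fintype X] (u : X → ℂ)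
    (P : Matrix (X × Y) (X × Y) ℂ) : Matrix Y Y ℂ :=
  Matrix.of fun y y₁ => ∑ x, ∑ x₁, star (u x) * P (x, y) (x₁, y₁) * u x₁

lemma partialContract_posSemidef {X Y : Type*} [Fintype X] [Fintype Y] (u : X → ℂ)
    {P : Matrix (X × Y) (X × Y) ℂ} (hP : P.PosSemidef) : (partialContract u P).PosSemidef := by
  classical
  let W : Matrix (X × Y) Y ℂ := Matrix.of fun p y => if p.2 = y then u p.1 else 0
  have hW : partialContract u P = W.conjTranspose * P * W := by
    ext y y₁
    simp only [partialContract, W, Matrix.mul_apply, Matrix.conjTranspose_apply, Matrix.of_apply,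
      Fintype.sum_prod_type, Finset.sum_mul, apply_ite star, star_zero, ite_mul, mul_ite,
      zero_mul, mul_zero, Finset.sum_ite_eq', Finset.mem_univ, if_true]
    exact Finset.sum_comm
  rw [hW]
  exact hP.conjTranspose_mul_mul_same W

lemma trace_partialContract {X Y : Type*} [Fintype X] [Fintype Y] (u : X → ℂ)
    (P : Matrix (X × Y) (X × Y) ℂ) :
    (partialContract u P).trace =
      ∑ y, star u ⬝ᵥ (P.submatrix (fun x => (x, y)) fun x => (x, y)).mulVec u := by
  simp only [partialContract, Matrix.trace, Matrix.diag_apply, Matrix.of_apply, dotProduct,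
    Matrix.mulVec, Matrix.submatrix_apply, Finset.mul_sum, Pi.star_apply, mul_assoc]

/-- The operator on `B'` steered to by the effect `⟨a| E |a⟩` applied to the share `A'`
of `η`. -/
noncomputable def steered {A A' B' : Type*} [Fintype A']
    (E : Matrix (A × A') (A × A') ℂ) (η : Matrix (A' × B') (A' × B') ℂ) (a : A) :
    Matrix B' B' ℂ :=
  Matrix.of fun b₁ b => ∑ a', ∑ a₁', E (a, a') (a, a₁') * η (a₁', b₁) (a', b)

lemma steered_posSemidef {A A' B' : Type*} [Fintype A] [Fintype A'] [Fintype B']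
    {E : Matrix (A × A') (A × A') ℂ} {η : Matrix (A' × B') (A' × B') ℂ}
    (hE : E.PosSemidef) (hη : η.PosSemidef) (a : A) : (steered E η a).PosSemidef := by
  classical
  obtain ⟨G, rfl⟩ := exists_eq_conjTranspose_mul_self hE
  have hsum : steered (G.conjTranspose * G) η a =
      ∑ k, partialContract (fun a' => star (G k (a, a'))) η := by
    ext b₁ b
    simp only [steered, partialContract, Matrix.sum_apply, Matrix.of_apply, Matrix.mul_apply,
      Matrix.conjTranspose_apply, Finset.sum_mul, star_star]
    refine Finset.sum_comm.trans (Eq.trans ?_ Finset.sum_comm)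
    refine Finset.sum_congr rfl fun a₁' _ => ?_
    rw [Finset.sum_comm]
    exact Finset.sum_congr rfl fun k _ => Finset.sum_congr rfl fun a' _ => by ring
  rw [hsum]
  exact Matrix.posSemidef_sum _ fun k _ => partialContract_posSemidef _ hη

/-- For a POVM, the steered operators have total trace `tr η`. -/
lemma sum_trace_steered {ι A A' B' : Type*} [Fintype ι] [Fintype A] [Fintype A'] [Fintype B']
    [DecidableEq A] [DecidableEq A'] {E : ι → Matrix (A × A') (A × A') ℂ} (hE : IsPOVM E)
    (η : Matrix (A' × B') (A' × B') ℂ) (a : A) :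
    ∑ α, (steered (E α) η a).trace = η.trace := by
  have h : ∀ a' a₁', ∑ α, E α (a, a') (a, a₁') = if a' = a₁' then 1 else 0 := by
    intro a' a₁'
    rw [← Matrix.sum_apply, hE.2, Matrix.one_apply]
    simp
  simp only [steered, Matrix.trace, Matrix.diag_apply, Matrix.of_apply]
  rw [Finset.sum_comm, Fintype.sum_prod_type, Finset.sum_comm (s := Finset.univ (α := A'))]
  refine Finset.sum_congr rfl fun b _ => ?_
  rw [Finset.sum_comm]
  refine Finset.sum_congr rfl fun a' _ => ?_
  rw [Finset.sum_comm]
  simp only [← Finset.sum_mul, h, ite_mul, one_mul, zero_mul, Finset.sum_ite_eq,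
    Finset.mem_univ, if_true]

lemma corrProb_rhoMUB' {d : ℕ} {A' B' : Type*} [Fintype A'] [Fintype B']
    (e : Fin d → Fin d → Fin d → ℂ) (x : Fin d)
    (E : Matrix (Fin d × A') (Fin d × A') ℂ) (F : Matrix (Fin d × B') (Fin d × B') ℂ)
    (η : Matrix (A' × B') (A' × B') ℂ) :
    corrProb E F (rhoMUB' d e x) η =
      (1 / (d : ℂ)) * ∑ a, (partialContract (e a x) F * steered E η a).trace := by
  simp only [corrProb, rhoMUB', Matrix.of_apply, partialContract, steered, Matrix.trace,
    Matrix.diag_apply, Matrix.mul_apply, mul_ite, ite_mul, mul_zero, zero_mul, Finset.mul_sum]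
  refine Finset.sum_congr rfl fun a _ => ?_
  simp only [Finset.sum_ite_irrel, Finset.sum_const_zero, Finset.sum_ite_eq',
    Finset.mem_univ, if_true]
  simp only [Finset.sum_mul, Finset.mul_sum]
  trans ∑ p : Fin d × Fin d, ∑ q : A' × A', ∑ r : B' × B', (1 / (d : ℂ)) *
    (star (e a x p.1) * F (p.1, r.1) (p.2, r.2) * e a x p.2 *
      (E (a, q.1) (a, q.2) * η (q.2, r.2) (q.1, r.1)))
  · simp only [Fintype.sum_prod_type, Complex.star_def]
    refine Finset.sum_congr rfl fun b _ => Finset.sum_congr rfl fun b₁ _ =>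
      Finset.sum_congr rfl fun a' _ => Finset.sum_congr rfl fun a₁' _ =>
      Finset.sum_congr rfl fun b' _ => Finset.sum_congr rfl fun b₁' _ => by ring
  · rw [Finset.sum_congr rfl fun p _ => Finset.sum_comm, Finset.sum_comm,
      Finset.sum_congr rfl fun r _ => Finset.sum_comm]
    simp only [Fintype.sum_prod_type]

/-- A weighted sum with weights of total mass one is at most some single term. -/
lemma exists_sum_mul_le {ι : Type*} [Fintype ι] (p h : ι → ℝ) (hp : ∀ i, 0 ≤ p i)
    (hp1 : ∑ i, p i = 1) : ∃ i, ∑ j, p j * h j ≤ h i := by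
  have hne : (Finset.univ : Finset ι).Nonempty := by
    rw [Finset.nonempty_iff_ne_empty]
    intro h0
    simp [h0] at hp1
  obtain ⟨i, -, hi⟩ := Finset.exists_max_image Finset.univ h hne
  refine ⟨i, ?_⟩
  calc ∑ j, p j * h j ≤ ∑ j, p j * h i :=
        Finset.sum_le_sum fun j hj => mul_le_mul_of_nonneg_left (hi j hj) (hp j)
    _ = h i := by rw [← Finset.sum_mul, hp1, one_mul]

/-- Summing the contractions along one vector from each mutually unbiased basis costs at most
a factor `2√d` relative to the trace. -/
lemma sum_trace_partialContract_re_le {d : ℕ} (hd : 0 < d) {B' : Type*} [Fintype B']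
    {e : Fin d → Fin d → Fin d → ℂ} (he : MutuallyUnbiasedBases e)
    {P : Matrix (Fin d × B') (Fin d × B') ℂ} (hP : P.PosSemidef) (x : Fin d → Fin d) :
    ∑ a, (partialContract (e a (x a)) P).trace.re ≤ 2 * Real.sqrt d * P.trace.re := by
  have hd1 : (1 : ℝ) ≤ d := by exact_mod_cast hd
  have hs1 : 1 ≤ Real.sqrt d := Real.one_le_sqrt.mpr hd1
  have htr : P.trace.re = ∑ y, (P.submatrix (fun x => (x, y)) fun x => (x, y)).trace.re := by
    simp only [Matrix.trace, Matrix.diag_apply, Matrix.submatrix_apply, Complex.re_sum,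
      Fintype.sum_prod_type]
    exact Finset.sum_comm
  simp only [trace_partialContract, Complex.re_sum]
  rw [Finset.sum_comm, htr, Finset.mul_sum]
  refine Finset.sum_le_sum fun y _ => ?_
  have hPy := hP.submatrix (fun x : Fin d => (x, y))
  refine (sum_dotProduct_mulVec_re_le hPy (fun a => e a (x a)) (1 / Real.sqrt d)
    (by positivity) (fun a => (he.1 a (x a) (x a)).trans (if_pos rfl)) fun a b hab => ?_).trans ?_
  · have h := he.2 a b hab (x a) (x b)
    refine le_of_eq ?_
    rw [← Real.sqrt_sq (norm_nonneg (star (e a (x a)) ⬝ᵥ e b (x b)))]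
    rw [show ‖star (e a (x a)) ⬝ᵥ e b (x b)‖ ^ 2 = 1 / d from h]
    rw [Real.sqrt_div zero_le_one, Real.sqrt_one]
  · have hn : 0 ≤ (P.submatrix (fun x : Fin d => (x, y)) fun x => (x, y)).trace.re :=
      (Complex.le_def.mp hPy.trace_nonneg).1
    refine mul_le_mul_of_nonneg_right ?_ hn
    rw [Fintype.card_fin, one_div_mul_eq_div, Real.div_sqrt]
    linarith

/-- **Upper bound on the success probability, `d` mutually unbiased bases.**
For `d` mutually unbiased bases `{|e^a_x⟩}` of `ℂ^d` and the states
`ρ^x = (1/d) ∑ a, |a⟩⟨a| ⊗ |e^a_x⟩⟨e^a_x|` given with uniform prior `1/d`, any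
instantaneous strategy — shared entangled state `η` on `A' ⊗ B'`, local POVMs `{E^α}` on
`A ⊗ A'` and `{F^β}` on `B ⊗ B'`, and post-processing `g` — guesses `x` with probability
`p_succ = (1/d) ∑_x ∑_{(α,β) : g(α,β)=x} tr[(E^α ⊗ F^β)(ρ^x ⊗ η)] ≤ 2 dim(B')/√d`. -/
theorem success_prob_bound' (d : ℕ) (hd : 2 ≤ d)
    (e : Fin d → Fin d → Fin d → ℂ) (he : MutuallyUnbiasedBases e)
    (dA' dB' : ℕ)
    (η : Matrix (Fin dA' × Fin dB') (Fin dA' × Fin dB') ℂ)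
    (hη : η.PosSemidef) (hη1 : η.trace = 1)
    (nI nJ : ℕ)
    (E : Fin nI → Matrix (Fin d × Fin dA') (Fin d × Fin dA') ℂ)
    (hE : IsPOVM E)
    (F : Fin nJ → Matrix (Fin d × Fin dB') (Fin d × Fin dB') ℂ)
    (hF : IsPOVM F)
    (g : Fin nI → Fin nJ → Fin d) :
    ((1 / (d : ℂ)) * ∑ x : Fin d, ∑ α, ∑ β,
        if g α β = x then corrProb (E α) (F β) (rhoMUB' d e x) η else 0).re ≤
      2 * (dB' : ℝ) / Real.sqrt d := by
  have hd0 : (0 : ℝ) < d := by exact_mod_cast (by omega : 0 < d)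
  set N : Fin d → Fin nI → Fin nJ → ℝ :=
    fun a α β => (partialContract (e a (g α β)) (F β)).trace.re with hN
  set p : Fin d → Fin nI → ℝ := fun a α => (steered (E α) η a).trace.re with hp
  have hp0 : ∀ a α, 0 ≤ p a α := fun a α =>
    (Complex.le_def.mp (steered_posSemidef (hE.1 α) hη a).trace_nonneg).1
  have hp1 : ∀ a, ∑ α, p a α = 1 := by
    intro a
    rw [hp, ← Complex.re_sum, sum_trace_steered hE, hη1, Complex.one_re]
  have hterm : ∀ α β, (corrProb (E α) (F β) (rhoMUB' d e (g α β)) η).re ≤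
      1 / d * ∑ a, p a α * N a α β := by
    intro α β
    rw [corrProb_rhoMUB', show (1 / (d : ℂ)) = ((1 / d : ℝ) : ℂ) by push_cast; rfl,
      Complex.re_ofReal_mul, Complex.re_sum]
    refine mul_le_mul_of_nonneg_left (Finset.sum_le_sum fun a _ => ?_) (by positivity)
    rw [mul_comm (p a α)]
    exact trace_mul_re_le (partialContract_posSemidef _ (hF.1 β))
      (steered_posSemidef (hE.1 α) hη a)
  choose s hs using fun a => exists_sum_mul_le (p a) (fun α => ∑ β, N a α β) (hp0 a) (hp1 a)
  have htrF : ∑ β, (F β).trace.re = d * dB' := by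
    rw [← Complex.re_sum, ← Matrix.trace_sum, hF.2, Matrix.trace_one]
    simp
  have hmain : ∑ α, ∑ β, ∑ a, p a α * N a α β ≤ 2 * Real.sqrt d * (d * dB') := by
    calc ∑ α, ∑ β, ∑ a, p a α * N a α β = ∑ a, ∑ α, p a α * ∑ β, N a α β := by
          rw [Finset.sum_comm (s := Finset.univ (α := Fin d))]
          refine Finset.sum_congr rfl fun α _ => ?_
          rw [Finset.sum_comm]
          simp only [Finset.mul_sum]
      _ ≤ ∑ a, ∑ β, N a (s a) β := Finset.sum_le_sum fun a _ => hs a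
      _ = ∑ β, ∑ a, N a (s a) β := Finset.sum_comm
      _ ≤ ∑ β, 2 * Real.sqrt d * (F β).trace.re := Finset.sum_le_sum fun β _ =>
          sum_trace_partialContract_re_le (by omega) he (hF.1 β) fun a => g (s a) β
      _ = 2 * Real.sqrt d * (d * dB') := by rw [← Finset.mul_sum, htrF]
  have hcollapse : ∑ x : Fin d, ∑ α, ∑ β,
      (if g α β = x then corrProb (E α) (F β) (rhoMUB' d e x) η else 0) =
      ∑ α, ∑ β, corrProb (E α) (F β) (rhoMUB' d e (g α β)) η := by
    rw [Finset.sum_comm]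
    refine Finset.sum_congr rfl fun α _ => ?_
    rw [Finset.sum_comm]
    simp
  rw [hcollapse, show (1 / (d : ℂ)) = ((1 / d : ℝ) : ℂ) by push_cast; rfl,
    Complex.re_ofReal_mul]
  simp only [Complex.re_sum]
  calc 1 / (d : ℝ) * ∑ α, ∑ β, (corrProb (E α) (F β) (rhoMUB' d e (g α β)) η).re
      ≤ 1 / d * ∑ α, ∑ β, 1 / d * ∑ a, p a α * N a α β :=
        mul_le_mul_of_nonneg_left (Finset.sum_le_sum fun α _ =>
          Finset.sum_le_sum fun β _ => hterm α β) (by positivity)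
    _ = 1 / d * (1 / d * ∑ α, ∑ β, ∑ a, p a α * N a α β) := by simp only [Finset.mul_sum]
    _ ≤ 1 / d * (1 / d * (2 * Real.sqrt d * (d * dB'))) := by gcongr
    _ = 2 * dB' / Real.sqrt d := by
        have hsq := Real.mul_self_sqrt hd0.le
        have hs0 : Real.sqrt d ≠ 0 := (Real.sqrt_pos.mpr hd0).ne'
        field_simp
        nlinarith
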